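/- Let d = (d_n) be a decreasing sequence of positive real numbers such that the weighted Hardy space H²(d) is invariant under composition with every disc automorphism (each C_{ψ_a}, where ψ_a(z) = (a−z)/(1−āz) for a ∈ 𝔻, is bounded on H²(d), with ‖C_{ψ_a}‖_{H²(d)} ≤ ((1+|a|)/(1−|a|))^{Λ/2} for a constant Λ depending only on d). Let φ: 𝔻 → 𝔻 be holomorphic with Denjoy–Wolff point in 𝔻, and let w ∈ H² be such that T_{w,φ} is bounded on H² (and hence also bounded on H²(d)). Then: (i) if ‖T_{w,φ}ⁿ‖_{H²} → 0, then ‖T_{w,φ}ⁿ‖_{H²(d)} → 0; and (ii) if T_{w,φ}ⁿ → 0 strongly on H², then T_{w,φ}ⁿ → 0 strongly on H²(d). -/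

import Mathlib

open Complex Metric Filter Topology

/-- The Hardy space `H²`, realized as the sequence space `ℓ²` of Taylor coefficients. -/
noncomputable abbrev H2 : Type := lp (fun _ : ℕ => ℂ) 2

/-- Evaluation of an element of `H²` (a coefficient sequence) at a point of the disc. -/
noncomputable def H2.eval (f : H2) (z : ℂ) : ℂ := ∑' n : ℕ, f n * z ^ n

/-- The weighted Hardy space `H²(d)` is realized on the same sequence space `ℓ²`: the
sequence `a ∈ ℓ²` represents the holomorphic function with Taylor coefficients
`c_n = a_n / d_n`, so that `‖a‖² = ∑ |c_n|² d_n²`.  `Hd.eval` evaluates the represented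
function at a point of the disc. -/
noncomputable def Hd.eval (d : ℕ → ℝ) (f : H2) (z : ℂ) : ℂ :=
  ∑' n : ℕ, (f n / (d n : ℂ)) * z ^ n

/-- The involutive disc automorphism `ψ_a(z) = (a − z)/(1 − ā z)`. -/
noncomputable def psiAut (a z : ℂ) : ℂ := (a - z) / (1 - (starRingEnd ℂ) a * z)

lemma hs_horner {E : Type*} [NormedAddCommGroup E] [InnerProductSpace ℂ E]
    (V : E →L[ℂ] E) (u : E) (hV : ∀ x, ‖V x‖ = ‖x‖) (hu : ∀ x, inner ℂ (V x) u = 0)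
    (N : ℕ) : ∀ (c : ℕ → ℂ), ‖∑ n ∈ Finset.range N, c n • (V ^ n) u‖ ^ 2
      = (∑ n ∈ Finset.range N, ‖c n‖ ^ 2) * ‖u‖ ^ 2 := by
  induction N with
  | zero => intro c; simp
  | succ N ih =>
    intro c
    rw [Finset.sum_range_succ', Finset.sum_range_succ']
    have h1 : ∑ n ∈ Finset.range N, c (n+1) • (V ^ (n+1)) u
        = V (∑ n ∈ Finset.range N, c (n+1) • (V ^ n) u) := by
      rw [map_sum]
      refine Finset.sum_congr rfl fun n _ => ?_
      rw [map_smul, pow_succ']; rfl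
    rw [h1]
    set y := ∑ n ∈ Finset.range N, c (n+1) • (V ^ n) u
    have h2 := ih (fun n => c (n+1))
    have h3 : ‖V y + c 0 • (V ^ 0) u‖ ^ 2 = ‖V y‖ ^ 2 + ‖c 0 • (V ^ 0) u‖ ^ 2 := by
      have := norm_add_sq (𝕜 := ℂ) (V y) (c 0 • (V ^ 0) u)
      rw [this, inner_smul_right, pow_zero, ContinuousLinearMap.one_apply, hu]
      simp
    rw [h3, hV, h2, norm_smul, pow_zero, ContinuousLinearMap.one_apply]
    ring

lemma hs_abstract {E : Type*} [NormedAddCommGroup E] [InnerProductSpace ℂ E] [CompleteSpace E]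
    (S : E →ₗᵢ[ℂ] E) (e : E) (he : ∀ x, inner ℂ (S x) e = 0) (a : ℂ) (ha : ‖a‖ < 1) :
    ∃ (V : E →L[ℂ] E) (u : E), (∀ x, ‖V x‖ = ‖x‖) ∧ (∀ x, inner ℂ (V x) u = 0) ∧
      u - (starRingEnd ℂ a) • S u = e ∧
      ∀ x, V x - (starRingEnd ℂ a) • S (V x) = a • x - S x := by
  set b := starRingEnd ℂ a with hb
  have hbn : ‖b‖ = ‖a‖ := by simp [hb]
  let Sc : E →L[ℂ] E := S.toContinuousLinearMap
  have hSc : ∀ x, Sc x = S x := fun x => rfl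
  have hn : ‖b • Sc‖ < 1 := by
    refine lt_of_le_of_lt ?_ ha
    refine ContinuousLinearMap.opNorm_le_bound _ (norm_nonneg _) fun x => ?_
    rw [ContinuousLinearMap.smul_apply, norm_smul, hSc, S.norm_map, hbn]
  obtain ⟨A, hA⟩ := isUnit_one_sub_of_norm_lt_one hn
  let R : E →L[ℂ] E := ↑A⁻¹
  have hAR : ∀ x, R x - b • S (R x) = x := by
    intro x
    have : ((A : E →L[ℂ] E) * R) x = x := by simp [R]
    rw [hA] at this
    simpa [hSc] using this
  have hu : ∀ y : E, inner ℂ (a • y - S y) (R e) = 0 := by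
    intro y
    have h1 : R e = e + b • S (R e) := by
      have := hAR e
      rw [sub_eq_iff_eq_add] at this
      exact this
    have h2 : inner ℂ (S y) (R e) = b * inner ℂ y (R e) := by
      conv_lhs => rw [h1]
      rw [inner_add_right, he, inner_smul_right, S.inner_map_map, zero_add]
    rw [inner_sub_left, inner_smul_left, h2]
    simp [hb]
  refine ⟨(a • (1 : E →L[ℂ] E) - Sc) * R, R e, ?_, ?_, hAR e, ?_⟩
  · intro x
    have h0 : ((a • (1 : E →L[ℂ] E) - Sc) * R) x = a • R x - S (R x) := rfl
    rw [h0]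
    set y := R x with hy
    have h1 : x = y - b • S y := (hAR x).symm
    have h2 : ‖a • y - S y‖ ^ 2 = ‖x‖ ^ 2 := by
      rw [h1, norm_sub_sq (𝕜 := ℂ), norm_sub_sq (𝕜 := ℂ), norm_smul, norm_smul, S.norm_map,
        inner_smul_left, inner_smul_right, hbn]
      ring
    exact (sq_eq_sq₀ (norm_nonneg _) (norm_nonneg _)).1 h2
  · intro x
    exact hu (R x)
  · intro x
    have h0 : ((a • (1 : E →L[ℂ] E) - Sc) * R) x = a • R x - S (R x) := rfl
    rw [h0]
    conv_rhs => rw [← hAR x]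
    simp only [map_sub, map_smul, smul_sub]
    rw [smul_comm a b]
    abel

lemma hs_two : (0:ℝ) < (2 : ENNReal).toReal := by norm_num

lemma hs_norm_sq (f : H2) : HasSum (fun n => ‖f n‖ ^ 2) (‖f‖ ^ 2) := by
  have := lp.hasSum_norm hs_two f
  simpa using this

lemma hs_mem {g : ℕ → ℂ} (h : Summable (fun n => ‖g n‖ ^ 2)) : Memℓp g 2 := by
  apply memℓp_gen
  simpa using h

/-- right shift -/
noncomputable def hsFun (f : H2) : ℕ → ℂ := fun n => Nat.casesOn n 0 (fun m => f m)

lemma hsFun_hasSum (f : H2) : HasSum (fun n => ‖hsFun f n‖ ^ 2) (‖f‖ ^ 2) := by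
  have h := hs_norm_sq f
  rw [← hasSum_nat_add_iff' 1]
  simpa [hsFun] using h

noncomputable def hsShift : H2 →ₗᵢ[ℂ] H2 where
  toFun f := ⟨hsFun f, hs_mem (hsFun_hasSum f).summable⟩
  map_add' f g := by
    ext n
    cases n
    · exact (add_zero (0:ℂ)).symm
    · rfl
  map_smul' c f := by
    ext n
    cases n <;> simp [hsFun]
  norm_map' f := by
    have h1 := hs_norm_sq (⟨hsFun f, hs_mem (hsFun_hasSum f).summable⟩ : H2)
    have h2 := h1.unique (hsFun_hasSum f)
    exact (sq_eq_sq₀ (norm_nonneg _) (norm_nonneg _)).1 h2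

lemma hsShift_zero (f : H2) : hsShift f 0 = 0 := rfl
lemma hsShift_succ (f : H2) (n : ℕ) : hsShift f (n+1) = f n := rfl

lemma hs_summable (c : ℕ → ℂ) (hc : ∀ r : ℝ, 0 < r → r < 1 → ∃ C, ∀ n, ‖c n‖ * r ^ n ≤ C)
    (z : ℂ) (hz : ‖z‖ < 1) : Summable (fun n => c n * z ^ n) := by
  obtain ⟨r, hr1, hr2⟩ := exists_between hz
  have hr0 : 0 < r := lt_of_le_of_lt (norm_nonneg _) hr1
  obtain ⟨C, hC⟩ := hc r hr0 hr2
  have hq : ‖z‖ / r < 1 := (div_lt_one hr0).2 hr1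
  refine Summable.of_norm_bounded
    ((summable_geometric_of_lt_one (by positivity) hq).mul_left C) fun n => ?_
  rw [norm_mul, norm_pow]
  calc ‖c n‖ * ‖z‖ ^ n = (‖c n‖ * r ^ n) * (‖z‖ / r) ^ n := by
        rw [div_pow]; field_simp
    _ ≤ C * (‖z‖ / r) ^ n := by gcongr; exact hC n

lemma hs_inj (b c : ℕ → ℂ) (hb : ∀ z : ℂ, ‖z‖ < 1 → Summable (fun n => b n * z ^ n))
    (hc : ∀ z : ℂ, ‖z‖ < 1 → Summable (fun n => c n * z ^ n))
    (h : ∀ z : ℂ, ‖z‖ < 1 → ∑' n, b n * z ^ n = ∑' n, c n * z ^ n) : b = c := by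
  have key : ∀ g : ℕ → ℂ, (∀ z : ℂ, ‖z‖ < 1 → Summable (fun n => g n * z ^ n)) →
      (∀ z : ℂ, ‖z‖ < 1 → ∑' n, g n * z ^ n = ∑' n, b n * z ^ n) →
      HasFPowerSeriesAt (fun z => ∑' n, b n * z ^ n)
        (FormalMultilinearSeries.ofScalars ℂ g) 0 := by
    intro g hg hgb
    rw [hasFPowerSeriesAt_iff]
    filter_upwards [Metric.ball_mem_nhds (0:ℂ) one_pos] with z hz
    rw [mem_ball_zero_iff] at hz
    have := (hg z hz).hasSum
    rw [hgb z hz] at this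
    simpa [FormalMultilinearSeries.coeff_ofScalars, mul_comm] using this
  have h1 := key b hb (fun _ _ => rfl)
  have h2 := key c hc (fun z hz => (h z hz).symm)
  have h3 := h1.eq_formalMultilinearSeries h2
  funext n
  have := congrArg (fun p => p.coeff n) h3
  simpa [FormalMultilinearSeries.coeff_ofScalars] using this

lemma hs_coe_le (f : H2) (n : ℕ) : ‖f n‖ ≤ ‖f‖ := lp.norm_apply_le_norm two_ne_zero f n

lemma hs_H2_summable (f : H2) (z : ℂ) (hz : ‖z‖ < 1) : Summable (fun n => f n * z ^ n) := by
  refine hs_summable _ (fun r h0 h1 => ⟨‖f‖, fun n => ?_⟩) z hz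
  have := pow_le_one₀ (n := n) h0.le h1.le
  calc ‖f n‖ * r ^ n ≤ ‖f‖ * 1 := by gcongr; exact hs_coe_le f n
    _ = ‖f‖ := mul_one _

lemma hs_H2_inj (f g : H2) (h : ∀ z : ℂ, ‖z‖ < 1 → H2.eval f z = H2.eval g z) : f = g := by
  have := hs_inj (fun n => f n) (fun n => g n) (hs_H2_summable f) (hs_H2_summable g) h
  ext n
  exact congrFun this n

lemma hs_eval_comb (f g : H2) (s t : ℂ) (z : ℂ) (hz : ‖z‖ < 1) :
    H2.eval (s • f - t • g) z = s * H2.eval f z - t * H2.eval g z := by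
  unfold H2.eval
  rw [← tsum_mul_left, ← tsum_mul_left, ← Summable.tsum_sub ((hs_H2_summable f z hz).mul_left s)
    ((hs_H2_summable g z hz).mul_left t)]
  refine tsum_congr fun n => ?_
  have : (s • f - t • g : H2) n = s * f n - t * g n := rfl
  rw [this]
  ring

lemma hs_eval_shift (f : H2) (z : ℂ) (hz : ‖z‖ < 1) :
    H2.eval (hsShift f) z = z * H2.eval f z := by
  unfold H2.eval
  rw [(hs_H2_summable (hsShift f) z hz).tsum_eq_zero_add, hsShift_zero, ← tsum_mul_left]
  simp only [zero_mul, zero_add, hsShift_succ]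
  refine tsum_congr fun n => ?_
  ring

lemma hs_eval_single (n : ℕ) (z : ℂ) : H2.eval (lp.single 2 n 1) z = z ^ n := by
  unfold H2.eval
  rw [tsum_eq_single n]
  · simp
  · intro m hm
    simp [hm]

lemma hs_C2_bound (a : ℂ) (ha : ‖a‖ < 1) (C : H2 →L[ℂ] H2)
    (hC : ∀ (f : H2), ∀ z ∈ ball (0:ℂ) 1, H2.eval (C f) z = H2.eval f (psiAut a z)) :
    ‖C‖ ≤ 2 / (1 - ‖a‖) := by
  have h1a : 0 < 1 - ‖a‖ := by linarith
  have he : ∀ x : H2, inner ℂ (hsShift x) (lp.single 2 0 1 : H2) = 0 := by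
    intro x
    rw [lp.inner_single_right, hsShift_zero]
    simp
  obtain ⟨V, u, hV, hVu, hu, hVx⟩ := hs_abstract hsShift (lp.single 2 0 1 : H2) he a ha
  set b := starRingEnd ℂ a with hb
  have hbn : ‖b‖ = ‖a‖ := by simp [hb]
  have hun : ‖u‖ ≤ 1 / (1 - ‖a‖) := by
    have h1 : u = (lp.single 2 0 1 : H2) + b • hsShift u := by
      rw [← hu]; abel
    have h2 : ‖u‖ ≤ 1 + ‖a‖ * ‖u‖ := by
      calc ‖u‖ = ‖(lp.single 2 0 1 : H2) + b • hsShift u‖ := by rw [← h1]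
        _ ≤ ‖(lp.single 2 0 1 : H2)‖ + ‖b • hsShift u‖ := norm_add_le _ _
        _ = 1 + ‖a‖ * ‖u‖ := by
          rw [lp.norm_single (by norm_num), norm_smul, hbn, hsShift.norm_map]; simp
    rw [le_div_iff₀ h1a]
    linarith
  have hden : ∀ z : ℂ, ‖z‖ < 1 → 1 - b * z ≠ 0 := by
    intro z hz h
    have : b * z = 1 := by rw [sub_eq_zero] at h; exact h.symm
    have h2 : ‖b‖ * ‖z‖ = 1 := by rw [← norm_mul, this]; simp
    rw [hbn] at h2
    nlinarith [norm_nonneg a, norm_nonneg z]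
  have hev : ∀ n : ℕ, ∀ z : ℂ, ‖z‖ < 1 →
      (1 - b * z) * H2.eval ((V ^ n) u) z = psiAut a z ^ n := by
    intro n z hz
    have hA : ∀ y : H2, H2.eval (y - b • hsShift y) z = (1 - b * z) * H2.eval y z := by
      intro y
      have := hs_eval_comb y (hsShift y) 1 b z hz
      rw [one_smul, hs_eval_shift _ _ hz] at this
      rw [this]; ring
    induction n with
    | zero =>
      rw [pow_zero, pow_zero, ContinuousLinearMap.one_apply, ← hA, hu, hs_eval_single, pow_zero]
    | succ n ih =>
      have h1 : (V ^ (n+1)) u = V ((V ^ n) u) := by rw [pow_succ']; rfl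
      rw [h1, ← hA, hVx]
      have := hs_eval_comb ((V ^ n) u) (hsShift ((V ^ n) u)) a 1 z hz
      rw [one_smul, hs_eval_shift _ _ hz] at this
      rw [this, pow_succ, ← ih, psiAut, ← hb]
      have hd := hden z hz
      rw [mul_comm (1 - b * z), mul_assoc, mul_div_cancel₀ _ hd]
      ring
  have hCe : ∀ n : ℕ, C (lp.single 2 n 1) = (V ^ n) u - b • hsShift ((V ^ n) u) := by
    intro n
    apply hs_H2_inj
    intro z hz
    rw [hC _ z (by simpa using hz), hs_eval_single, ← hev n z hz]
    have := hs_eval_comb ((V ^ n) u) (hsShift ((V ^ n) u)) 1 b z hz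
    rw [one_smul, hs_eval_shift _ _ hz] at this
    rw [this]; ring
  refine ContinuousLinearMap.opNorm_le_bound _ (by positivity) fun f => ?_
  have hlim := (lp.hasSum_single (by norm_num) f).tendsto_sum_nat
  have hlim2 := ((C.continuous.tendsto _).comp hlim).norm
  refine le_of_tendsto hlim2 (Eventually.of_forall fun N => ?_)
  simp only [Function.comp]
  set y := ∑ n ∈ Finset.range N, f n • (V ^ n) u with hy
  have h1 : C (∑ n ∈ Finset.range N, lp.single 2 n (f n)) = y - b • hsShift y := by
    rw [map_sum, hy, map_sum, Finset.smul_sum, ← Finset.sum_sub_distrib]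
    refine Finset.sum_congr rfl fun n _ => ?_
    have : (lp.single 2 n (f n) : H2) = f n • (lp.single 2 n 1 : H2) := by
      rw [← lp.single_smul]; simp
    rw [this, map_smul, hCe, map_smul, smul_sub, smul_comm]
  rw [h1]
  have h2 : ‖y‖ ≤ ‖f‖ * ‖u‖ := by
    have h3 := hs_horner V u hV hVu N (fun n => f n)
    have h4 : ∑ n ∈ Finset.range N, ‖f n‖ ^ 2 ≤ ‖f‖ ^ 2 :=
      sum_le_hasSum _ (fun _ _ => by positivity) (hs_norm_sq f)
    refine le_of_sq_le_sq ?_ (by positivity)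
    rw [h3, mul_pow]
    gcongr
  calc ‖y - b • hsShift y‖ ≤ ‖y‖ + ‖b • hsShift y‖ := norm_sub_le _ _
    _ = ‖y‖ + ‖a‖ * ‖y‖ := by rw [norm_smul, hbn, hsShift.norm_map]
    _ ≤ 2 * ‖y‖ := by nlinarith [norm_nonneg y]
    _ ≤ 2 * (‖f‖ * (1 / (1 - ‖a‖))) := by
      have : ‖f‖ * ‖u‖ ≤ ‖f‖ * (1 / (1 - ‖a‖)) := by gcongr
      linarith
    _ = 2 / (1 - ‖a‖) * ‖f‖ := by ring

lemma hs_Hd_summable (d : ℕ → ℝ) (hdpos : ∀ n, 0 < d n) (Cd : ℂ → (H2 →L[ℂ] H2))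
    (hCd : ∀ a ∈ ball (0:ℂ) 1, ∀ (f : H2), ∀ z ∈ ball (0:ℂ) 1,
      Hd.eval d (Cd a f) z = Hd.eval d f (psiAut a z)) (f : H2) (z : ℂ) (hz : ‖z‖ < 1) :
    Summable (fun n => (f n / (d n : ℂ)) * z ^ n) := by
  refine hs_summable _ (fun r h0 h1 => ⟨‖f‖ * (‖Cd r‖ / d 0), fun n => ?_⟩) z hz
  have hr : (r : ℂ) ∈ ball (0:ℂ) 1 := by
    rw [mem_ball_zero_iff, Complex.norm_real, Real.norm_eq_abs, abs_of_pos h0]; exact h1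
  have h := hCd r hr (lp.single 2 n 1) 0 (by simp)
  have e1 : ∀ g : H2, Hd.eval d g 0 = g 0 / (d 0 : ℂ) := by
    intro g
    unfold Hd.eval
    rw [tsum_eq_single 0]
    · simp
    · intro m hm; simp [hm]
  have e2 : Hd.eval d (lp.single 2 n 1) (psiAut r 0) = 1 / (d n : ℂ) * (r : ℂ) ^ n := by
    unfold Hd.eval
    rw [tsum_eq_single n]
    · simp [psiAut]
    · intro m hm; simp [hm]
  rw [e1, e2] at h
  have h2 := congrArg norm h
  have hd0 := hdpos 0
  have hdn := hdpos n
  have h3 : r ^ n / d n ≤ ‖Cd r‖ / d 0 := by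
    have e3 : r ^ n / d n = ‖(1 / (d n : ℂ)) * (r : ℂ) ^ n‖ := by
      rw [norm_mul, norm_div, norm_pow, Complex.norm_real, Complex.norm_real, Real.norm_eq_abs,
        Real.norm_eq_abs, abs_of_pos h0, abs_of_pos hdn, norm_one]
      ring
    rw [e3, ← h, norm_div, Complex.norm_real, Real.norm_eq_abs, abs_of_pos hd0]
    gcongr
    refine (hs_coe_le _ 0).trans (((Cd r).le_opNorm _).trans ?_)
    rw [lp.norm_single (by norm_num)]
    simp
  calc ‖f n / (d n : ℂ)‖ * r ^ n = ‖f n‖ * (r ^ n / d n) := by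
        rw [norm_div, Complex.norm_real, Real.norm_eq_abs, abs_of_pos hdn]; ring
    _ ≤ ‖f‖ * (‖Cd r‖ / d 0) := by
        gcongr
        exact hs_coe_le f n

lemma hs_iota (d : ℕ → ℝ) (hdpos : ∀ n, 0 < d n) (hdmono : Antitone d) (f : H2) :
    ∃ g : H2, (∀ n, g n = d n * f n) ∧ ‖g‖ ≤ d 0 * ‖f‖ := by
  have hle : ∀ n, ‖(d n : ℂ) * f n‖ ^ 2 ≤ d 0 ^ 2 * ‖f n‖ ^ 2 := by
    intro n
    rw [norm_mul, Complex.norm_real, Real.norm_eq_abs, abs_of_pos (hdpos n), mul_pow]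
    have := hdmono (Nat.zero_le n)
    have := (hdpos n).le
    gcongr
  have hs := (hs_norm_sq f).mul_left (d 0 ^ 2)
  have hs2 : Summable (fun n => ‖(d n : ℂ) * f n‖ ^ 2) :=
    Summable.of_nonneg_of_le (fun _ => by positivity) hle hs.summable
  refine ⟨⟨fun n => d n * f n, hs_mem hs2⟩, fun n => rfl, ?_⟩
  have h1 := hasSum_le hle (hs_norm_sq ⟨fun n => d n * f n, hs_mem hs2⟩) hs
  rw [← mul_pow] at h1
  have := hdpos 0
  exact le_of_sq_le_sq h1 (by positivity)

/-- Let `d = (d_n)` be a decreasing sequence of positive reals such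
that `H²(d)` is automorphism-invariant, with `‖C_{ψ_a}‖_{H²(d)} ≤ ((1+|a|)/(1−|a|))^{Λ/2}`.
Let `φ : 𝔻 → 𝔻` be holomorphic with Denjoy–Wolff point in `𝔻` and `w ∈ H²` with
`T = T_{w,φ}` bounded on `H²` (hence `Td`, its realization on `H²(d)`, is also bounded).
Then (i) `‖Tⁿ‖_{H²} → 0` implies `‖Tdⁿ‖_{H²(d)} → 0`, and (ii) if `Tⁿ → 0` strongly on
`H²` then `Tdⁿ → 0` strongly on `H²(d)`.  (One may use the inequality
`‖Tdⁿ‖ ≤ ‖C_{ψ_{φ_n(0)}}‖_{H²} ‖C_{ψ_{φ_n(0)}}‖_{H²(d)} ‖Tⁿ‖_{H²}`, hypothesis `hkey`.) -/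
theorem weighted_space_convergence_transfer
    (d : ℕ → ℝ) (hdpos : ∀ n, 0 < d n) (hdmono : Antitone d)
    (Λ : ℝ) (Cd : ℂ → (H2 →L[ℂ] H2))
    (hCd : ∀ a ∈ ball (0:ℂ) 1, ∀ (f : H2), ∀ z ∈ ball (0:ℂ) 1,
      Hd.eval d (Cd a f) z = Hd.eval d f (psiAut a z))
    (hCdbound : ∀ a ∈ ball (0:ℂ) 1, ‖Cd a‖ ≤ ((1 + ‖a‖) / (1 - ‖a‖)) ^ (Λ / 2))
    (C2 : ℂ → (H2 →L[ℂ] H2))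
    (hC2 : ∀ a ∈ ball (0:ℂ) 1, ∀ (f : H2), ∀ z ∈ ball (0:ℂ) 1,
      H2.eval (C2 a f) z = H2.eval f (psiAut a z))
    (φ w : ℂ → ℂ)
    (hφ : DifferentiableOn ℂ φ (ball (0:ℂ) 1))
    (hφmaps : Set.MapsTo φ (ball (0:ℂ) 1) (ball (0:ℂ) 1))
    (α : ℂ) (hα : α ∈ ball (0:ℂ) 1)
    (hDW : TendstoLocallyUniformlyOn (fun n z => φ^[n] z) (fun _ => α) atTop
      (ball (0:ℂ) 1))
    (W : H2) (hW : ∀ z ∈ ball (0:ℂ) 1, H2.eval W z = w z)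
    (T : H2 →L[ℂ] H2)
    (hT : ∀ (f : H2), ∀ z ∈ ball (0:ℂ) 1, H2.eval (T f) z = w z * H2.eval f (φ z))
    (Td : H2 →L[ℂ] H2)
    (hTd : ∀ (f : H2), ∀ z ∈ ball (0:ℂ) 1, Hd.eval d (Td f) z = w z * Hd.eval d f (φ z))
    (hkey : ∀ n : ℕ, ‖Td ^ n‖ ≤ ‖C2 (φ^[n] 0)‖ * ‖Cd (φ^[n] 0)‖ * ‖T ^ n‖) :
    (Tendsto (fun n : ℕ => ‖T ^ n‖) atTop (𝓝 0) →
      Tendsto (fun n : ℕ => ‖Td ^ n‖) atTop (𝓝 0)) ∧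
    ((∀ f : H2, Tendsto (fun n : ℕ => ‖(T ^ n) f‖) atTop (𝓝 0)) →
      ∀ f : H2, Tendsto (fun n : ℕ => ‖(Td ^ n) f‖) atTop (𝓝 0)) := by
  have ha : ∀ n, φ^[n] 0 ∈ ball (0:ℂ) 1 := fun n => hφmaps.iterate n (by simp)
  have ha' : ∀ n, ‖φ^[n] 0‖ < 1 := fun n => by simpa using ha n
  have hα' : ‖α‖ < 1 := by simpa using hα
  have hlim : Tendsto (fun n => φ^[n] 0) atTop (𝓝 α) :=
    hDW.tendsto_at (by simp : (0:ℂ) ∈ ball (0:ℂ) 1)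
  set G : ℝ → ℝ := fun t => 2 / (1 - t) * ((1 + t) / (1 - t)) ^ (Λ / 2) with hG
  have hGlim : Tendsto (fun n => G ‖φ^[n] 0‖) atTop (𝓝 (G ‖α‖)) := by
    have hc : ContinuousAt G ‖α‖ := by
      have h1 : 1 - ‖α‖ ≠ 0 := by linarith
      have h2 : (1 + ‖α‖) / (1 - ‖α‖) ≠ 0 :=
        div_ne_zero (by linarith [norm_nonneg α]) h1
      refine ContinuousAt.mul ?_ (ContinuousAt.rpow_const ?_ (Or.inl h2))
      · exact ContinuousAt.div continuousAt_const (by fun_prop) h1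
      · exact ContinuousAt.div (by fun_prop) (by fun_prop) h1
    exact hc.tendsto.comp hlim.norm
  have hb : ∀ n, ‖Td ^ n‖ ≤ G ‖φ^[n] 0‖ * ‖T ^ n‖ := by
    intro n
    refine (hkey n).trans ?_
    have h1 := hs_C2_bound _ (ha' n) (C2 (φ^[n] 0)) (hC2 _ (ha n))
    have h2 := hCdbound _ (ha n)
    have h3 := ha' n
    have h4 : 0 ≤ 2 / (1 - ‖φ^[n] 0‖) := (norm_nonneg _).trans h1
    simp only [hG]
    gcongr
  constructor
  · intro hTn
    refine squeeze_zero (fun n => norm_nonneg _) hb ?_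
    simpa using hGlim.mul hTn
  · intro hTn f
    obtain ⟨K, hK⟩ : ∃ K, ∀ n : ℕ, ‖T ^ n‖ ≤ K := by
      apply banach_steinhaus
      intro x
      obtain ⟨c, hc⟩ := (hTn x).bddAbove_range
      exact ⟨c, fun n => hc ⟨n, rfl⟩⟩
    obtain ⟨M, hM⟩ := hGlim.bddAbove_range
    have hM' : ∀ n, G ‖φ^[n] 0‖ ≤ M := fun n => hM ⟨n, rfl⟩
    have hTd' : ∀ n : ℕ, ‖Td ^ n‖ ≤ |M| * |K| := by
      intro n
      refine (hb n).trans ?_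
      have h1 := (hM' n).trans (le_abs_self M)
      have h2 := (hK n).trans (le_abs_self K)
      gcongr
    choose ι hι hιn using hs_iota d hdpos hdmono
    have hιe : ∀ g z, Hd.eval d (ι g) z = H2.eval g z := by
      intro g z
      unfold Hd.eval H2.eval
      refine tsum_congr fun n => ?_
      have : (d n : ℂ) ≠ 0 := by exact_mod_cast (hdpos n).ne'
      rw [hι]
      field_simp
    have hsum := hs_Hd_summable d hdpos Cd hCd
    have hint : ∀ g, Td (ι g) = ι (T g) := by
      intro g
      have h1 := hs_inj _ _ (hsum (Td (ι g))) (hsum (ι (T g))) (fun z hz => by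
        have hz' : z ∈ ball (0:ℂ) 1 := by simpa using hz
        change Hd.eval d _ z = Hd.eval d _ z
        rw [hTd _ z hz', hιe, hιe, hT _ z hz'])
      ext n
      have h2 := congrFun h1 n
      have : (d n : ℂ) ≠ 0 := by exact_mod_cast (hdpos n).ne'
      exact (div_left_inj' this).1 h2
    have hintn : ∀ n : ℕ, ∀ g, (Td ^ n) (ι g) = ι ((T ^ n) g) := by
      intro n
      induction n with
      | zero => intro g; simp
      | succ n ih =>
        intro g
        have e1 : (Td ^ (n+1)) (ι g) = (Td ^ n) (Td (ι g)) := by rw [pow_succ]; rfl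
        have e2 : (T ^ (n+1)) g = (T ^ n) (T g) := by rw [pow_succ]; rfl
        rw [e1, e2, hint, ih]
    have hιz : ∀ g, Tendsto (fun n : ℕ => ‖(Td ^ n) (ι g)‖) atTop (𝓝 0) := by
      intro g
      refine squeeze_zero (fun n => norm_nonneg _) (fun n => ?_)
        (by simpa only [mul_zero] using (hTn g).const_mul (d 0))
      rw [hintn]
      exact hιn _
    have happrox := (lp.hasSum_single (by norm_num) f).tendsto_sum_nat
    have hrange : ∀ N : ℕ, ∃ g, ι g = ∑ i ∈ Finset.range N, (lp.single 2 i (f i) : H2) := by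
      intro N
      refine ⟨∑ i ∈ Finset.range N, (lp.single 2 i (f i / (d i : ℂ)) : H2), ?_⟩
      ext n
      rw [hι]
      have : (d n : ℂ) ≠ 0 := by exact_mod_cast (hdpos n).ne'
      simp only [lp.coeFn_sum, Finset.sum_apply, lp.coeFn_single, Finset.sum_pi_single]
      split_ifs
      · field_simp
      · simp
    rw [Metric.tendsto_atTop]
    intro ε hε
    set B := |M| * |K| + 1 with hB
    have hBpos : 0 < B := by positivity
    rw [Metric.tendsto_atTop] at happrox
    obtain ⟨N, hN⟩ := happrox (ε / (2 * B)) (by positivity)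
    obtain ⟨g, hg⟩ := hrange N
    have hN' := hN N le_rfl
    rw [← hg, dist_comm, dist_eq_norm] at hN'
    have hgz := hιz g
    rw [Metric.tendsto_atTop] at hgz
    obtain ⟨n0, hn0⟩ := hgz (ε / 2) (by positivity)
    refine ⟨n0, fun n hn => ?_⟩
    have h1 := hn0 n hn
    rw [Real.dist_0_eq_abs, abs_of_nonneg (norm_nonneg _)] at h1 ⊢
    have h2 : (Td ^ n) f = (Td ^ n) (f - ι g) + (Td ^ n) (ι g) := by rw [map_sub]; abel
    have h3 : ‖(Td ^ n) (f - ι g)‖ ≤ B * ‖f - ι g‖ :=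
      (Td ^ n).le_of_opNorm_le ((hTd' n).trans (by linarith)) _
    have h4 : B * ‖f - ι g‖ < ε / 2 := by
      calc B * ‖f - ι g‖ < B * (ε / (2 * B)) := by gcongr
        _ = ε / 2 := by field_simp
    rw [h2]
    linarith [norm_add_le ((Td ^ n) (f - ι g)) ((Td ^ n) (ι g))]
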